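/- There exists a set X ⊆ ℕ that is reticently high for paths but not loquaciously high for paths. -/

import Mathlib

namespace CFT

open Nat.Partrec (Code)

/-- Relativized partial recursive functions: `f` is partial recursive in the
(total) oracle `O : ℕ → ℕ`.  This mirrors Mathlib's `Nat.Partrec`, with an
extra constructor for the oracle. -/
inductive RecursiveIn (O : ℕ → ℕ) : (ℕ →. ℕ) → Prop
  | zero : RecursiveIn O (pure 0)
  | succ : RecursiveIn O Nat.succ
  | left : RecursiveIn O ↑fun n : ℕ => n.unpair.1
  | right : RecursiveIn O ↑fun n : ℕ => n.unpair.2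
  | oracle : RecursiveIn O ↑O
  | pair {f g} : RecursiveIn O f → RecursiveIn O g →
      RecursiveIn O fun n => Nat.pair <$> f n <*> g n
  | comp {f g} : RecursiveIn O f → RecursiveIn O g →
      RecursiveIn O fun n => g n >>= f
  | prec {f g} : RecursiveIn O f → RecursiveIn O g →
      RecursiveIn O (Nat.unpaired fun a n =>
        n.rec (f a) fun y IH => do let i ← IH; g (Nat.pair a (Nat.pair y i)))
  | rfind {f} : RecursiveIn O f →
      RecursiveIn O fun a => Nat.rfind fun n => (fun m => m = 0) <$> f (Nat.pair a n)

/-- Partial functions between `Primcodable` types that are partial recursive in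
the oracle `O`. -/
def PartrecIn (O : ℕ → ℕ) {α σ : Type} [Primcodable α] [Primcodable σ] (f : α →. σ) : Prop :=
  RecursiveIn O fun n =>
    Part.bind (Part.ofOption (Encodable.decode (α := α) n)) fun a => (f a).map Encodable.encode

/-- Total functions between `Primcodable` types that are computable in the oracle `O`. -/
def ComputableIn (O : ℕ → ℕ) {α σ : Type} [Primcodable α] [Primcodable σ] (f : α → σ) : Prop :=
  PartrecIn O (f : α →. σ)

open Classical in
/-- The characteristic function of a set of naturals. -/
noncomputable def chi (A : Set ℕ) : ℕ → ℕ := fun n => if n ∈ A then 1 else 0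

/-- `A` is computably enumerable in (the characteristic function of) `X`. -/
def CEIn (X : Set ℕ) (A : Set ℕ) : Prop :=
  ∃ f : ℕ →. ℕ, PartrecIn (chi X) f ∧ ∀ n, n ∈ A ↔ (f n).Dom

/-- The `e`-th partial computable function `ℕ →. ℕ`. -/
def codeFn (e : ℕ) : ℕ →. ℕ := (Denumerable.ofNat Code e).eval

/-! ### Trees on ℕ -/

def PrefixClosed (T : Set (List ℕ)) : Prop := ∀ l ∈ T, ∀ l' : List ℕ, l' <+: l → l' ∈ T

/-- Index `e` decides a (prefix-closed) tree on `ℕ`. -/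
def DecidesTree (e : ℕ) : Prop :=
  (∀ n, (codeFn e n).Dom) ∧
    PrefixClosed {l : List ℕ | codeFn e (Encodable.encode l) = Part.some 1}

open Classical in
/-- The standard enumeration of computable trees on ℕ; indices that do not
decide a tree denote the empty tree. -/
noncomputable def treeAt (e : ℕ) : Set (List ℕ) :=
  if DecidesTree e then {l : List ℕ | codeFn e (Encodable.encode l) = Part.some 1} else ∅

/-- `f` is a path through the tree `T`: every finite initial segment
`[f 0, …, f (k-1)]` is in `T`. -/
def IsPath (T : Set (List ℕ)) (f : ℕ → ℕ) : Prop := ∀ k, (List.range k).map f ∈ T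

def IllFounded (T : Set (List ℕ)) : Prop := ∃ f, IsPath T f

/-- The set of indices of well-founded computable trees. -/
def WF : Set ℕ := {e | ¬ IllFounded (treeAt e)}

/-- `T` is a computable tree (prefix-closed and decided by a total computable function). -/
def ComputableTree (T : Set (List ℕ)) : Prop :=
  PrefixClosed T ∧ ∃ χ : List ℕ → Bool, Computable χ ∧ ∀ l, l ∈ T ↔ χ l = true

/-! ### Highness notions for paths -/

def HighForPaths (X : Set ℕ) : Prop :=
  ∀ T : Set (List ℕ), ComputableTree T → IllFounded T →
    ∃ f : ℕ → ℕ, ComputableIn (chi X) f ∧ IsPath T f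

def LoqHighForPaths (X : Set ℕ) : Prop :=
  ∃ F : ℕ × ℕ → ℕ, ComputableIn (chi X) F ∧
    ∀ e, IllFounded (treeAt e) → IsPath (treeAt e) fun n => F (e, n)

def UnifHighForPaths (X : Set ℕ) : Prop :=
  ∃ F : ℕ × ℕ →. ℕ, PartrecIn (chi X) F ∧
    ∀ e, IllFounded (treeAt e) →
      ∃ g : ℕ → ℕ, IsPath (treeAt e) g ∧ ∀ n, F (e, n) = Part.some (g n)

def RetHighForPaths (X : Set ℕ) : Prop :=
  ∃ F : ℕ × ℕ →. ℕ, PartrecIn (chi X) F ∧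
    (∀ e, IllFounded (treeAt e) →
      ∃ g : ℕ → ℕ, IsPath (treeAt e) g ∧ ∀ n, F (e, n) = Part.some (g n)) ∧
    (∀ e, ¬ IllFounded (treeAt e) → ∀ n, ¬ (F (e, n)).Dom)

/-! ### Σ¹₁ and Π¹₁ sets -/

def Sigma11 (A : Set ℕ) : Prop :=
  ∃ R : ℕ → List ℕ → Bool, Computable₂ R ∧
    ∀ n, n ∈ A ↔ ∃ f : ℕ → ℕ, ∀ k, R n ((List.range k).map f) = true

def Pi11 (A : Set ℕ) : Prop := Sigma11 Aᶜ

/-! ### Linear orders -/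

/-- A (presentation of a) linear order: a domain `D ⊆ ℕ` and a strict order
relation on it. -/
structure LinOrd where
  dom : Set ℕ
  lt : ℕ → ℕ → Prop

/-- `L` really is a strict linear order on its domain. -/
def LinOrd.IsValid (L : LinOrd) : Prop :=
  (∀ a b, L.lt a b → a ∈ L.dom ∧ b ∈ L.dom) ∧
  (∀ a, ¬ L.lt a a) ∧
  (∀ a b c, L.lt a b → L.lt b c → L.lt a c) ∧
  (∀ a ∈ L.dom, ∀ b ∈ L.dom, a = b ∨ L.lt a b ∨ L.lt b a)

def linOrdOfCodes (n : ℕ) : LinOrd :=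
  ⟨{a | codeFn n.unpair.1 a = Part.some 1},
   fun a b => codeFn n.unpair.2 (Nat.pair a b) = Part.some 1⟩

def DecidesLinOrd (n : ℕ) : Prop :=
  (∀ m, (codeFn n.unpair.1 m).Dom) ∧ (∀ m, (codeFn n.unpair.2 m).Dom) ∧
    (linOrdOfCodes n).IsValid

open Classical in
/-- The standard enumeration of computable linear orders; indices that do not
decide a linear order denote the empty order. -/
noncomputable def linOrdAt (n : ℕ) : LinOrd :=
  if DecidesLinOrd n then linOrdOfCodes n else ⟨∅, fun _ _ => False⟩

def IsDescSeq (L : LinOrd) (f : ℕ → ℕ) : Prop :=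
  ∀ i, f i ∈ L.dom ∧ L.lt (f (i + 1)) (f i)

def LinOrd.IllFounded (L : LinOrd) : Prop := ∃ f, IsDescSeq L f

/-- A tight descending sequence: a descending sequence that gets below every
descending sequence. -/
def IsTightDescSeq (L : LinOrd) (f : ℕ → ℕ) : Prop :=
  IsDescSeq L f ∧ ∀ g, IsDescSeq L g → ∀ n, ∃ m, L.lt (f m) (g n)

/-- `L` is a computable linear order. -/
def ComputableLinOrd (L : LinOrd) : Prop :=
  L.IsValid ∧
  (∃ χ : ℕ → Bool, Computable χ ∧ ∀ a, a ∈ L.dom ↔ χ a = true) ∧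
  (∃ χ : ℕ → ℕ → Bool, Computable₂ χ ∧ ∀ a b, L.lt a b ↔ χ a b = true)

def LoqHighForDS (X : Set ℕ) : Prop :=
  ∃ g : ℕ × ℕ → ℕ, ComputableIn (chi X) g ∧
    ∀ n, (linOrdAt n).IllFounded → IsDescSeq (linOrdAt n) fun k => g (n, k)

def HighForTightDS (X : Set ℕ) : Prop :=
  ∀ L : LinOrd, ComputableLinOrd L → L.IllFounded →
    ∃ f : ℕ → ℕ, ComputableIn (chi X) f ∧ IsTightDescSeq L f

def UnifHighForTightDS (X : Set ℕ) : Prop :=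
  ∃ F : ℕ × ℕ →. ℕ, PartrecIn (chi X) F ∧
    ∀ n, (linOrdAt n).IllFounded →
      ∃ g : ℕ → ℕ, IsTightDescSeq (linOrdAt n) g ∧ ∀ k, F (n, k) = Part.some (g k)

/-! ### Binary trees -/

def PrefixClosedB (B : Set (List Bool)) : Prop := ∀ l ∈ B, ∀ l' : List Bool, l' <+: l → l' ∈ B

def DecidesBTree (e : ℕ) : Prop :=
  (∀ n, (codeFn e n).Dom) ∧
    PrefixClosedB {l : List Bool | codeFn e (Encodable.encode l) = Part.some 1}

open Classical in
/-- The standard enumeration of computable binary trees; indices that do not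
decide a binary tree denote the full binary tree. -/
noncomputable def bTreeAt (e : ℕ) : Set (List Bool) :=
  if DecidesBTree e then {l : List Bool | codeFn e (Encodable.encode l) = Part.some 1}
  else Set.univ

def BInfinite (B : Set (List Bool)) : Prop := ∀ k, ∃ l ∈ B, l.length = k

def IsBPath (B : Set (List Bool)) (p : ℕ → Bool) : Prop := ∀ k, (List.range k).map p ∈ B

/-! ### Primitive recursive predicates -/

section Primrec

variable {α : Type} [Primcodable α]

theorem primrecPred_forall_lt {f : α → ℕ} {p : α → ℕ → Prop} (hf : Primrec f)
    (hp : PrimrecRel p) : PrimrecPred fun a => ∀ m < f a, p a m :=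
  ((PrimrecRel.forall_mem_list (R := fun m a => p a m) hp.swap).comp
    (Primrec.list_range.comp hf) Primrec.id).of_eq (by simp)

theorem primrecPred_imp {p q : α → Prop} (hp : PrimrecPred p) (hq : PrimrecPred q) :
    PrimrecPred fun a => p a → q a :=
  (hp.not.or hq).of_eq fun _ => imp_iff_not_or.symm

theorem primrec_list_map_range {f : α → ℕ} {g : α → ℕ → ℕ} (hf : Primrec f)
    (hg : Primrec₂ g) : Primrec fun a => (List.range (f a)).map (g a) :=
  Primrec.list_map (Primrec.list_range.comp hf) hg

theorem primrec_evaln_comp {s n : α → ℕ} {c : α → Code} (hs : Primrec s) (hc : Primrec c)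
    (hn : Primrec n) : Primrec fun a => Code.evaln (s a) (c a) (n a) :=
  Code.primrec_evaln.comp ((hs.pair hc).pair hn)

end Primrec

/-! ### Initial segments -/

/-- The initial segment `[f 0, …, f (k-1)]`. -/
def initSeg (f : ℕ → ℕ) (k : ℕ) : List ℕ := (List.range k).map f

@[simp] theorem length_initSeg (f : ℕ → ℕ) (k : ℕ) : (initSeg f k).length = k := by
  simp [initSeg]

theorem getElem?_initSeg (f : ℕ → ℕ) {i k : ℕ} (h : i < k) : (initSeg f k)[i]? = some (f i) := by
  simp [initSeg, h]

theorem getD_initSeg (f : ℕ → ℕ) {i k : ℕ} (h : i < k) (d : ℕ) :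
    (initSeg f k).getD i d = f i := by
  simp [initSeg, h]

theorem take_initSeg (f : ℕ → ℕ) (j k : ℕ) : (initSeg f k).take j = initSeg f (min j k) := by
  simp [initSeg, ← List.map_take, List.take_range]

theorem initSeg_congr {f g : ℕ → ℕ} {k : ℕ} (h : ∀ i < k, f i = g i) :
    initSeg f k = initSeg g k :=
  List.map_congr_left fun i hi => h i (List.mem_range.1 hi)

theorem initSeg_isPrefix (f : ℕ → ℕ) {j k : ℕ} (h : j ≤ k) : initSeg f j <+: initSeg f k := by
  rw [List.prefix_iff_eq_take, take_initSeg, length_initSeg, min_eq_left h]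

theorem initSeg_succ_cons (f : ℕ → ℕ) (k : ℕ) :
    initSeg f (k + 1) = f 0 :: initSeg (fun i => f (i + 1)) k := by
  simp [initSeg, List.range_succ_eq_map, Function.comp_def]

theorem eq_initSeg (l : List ℕ) : l = initSeg (fun i => l.getD i 0) l.length := by
  apply List.ext_getElem?
  intro i
  by_cases h : i < l.length
  · rw [getElem?_initSeg _ h]; simp [h]
  · simp [initSeg, h]

theorem isPath_iff {T : Set (List ℕ)} {f : ℕ → ℕ} : IsPath T f ↔ ∀ k, initSeg f k ∈ T :=
  Iff.rfl

/-! ### Primitive recursive certificates for paths -/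

/-- The list coded by a natural number. -/
def listOf (m : ℕ) : List ℕ := (Encodable.decode (α := List ℕ) m).getD []

@[simp] theorem listOf_encode (l : List ℕ) : listOf (Encodable.encode l) = l := by
  simp [listOf]

theorem primrec_listOf : Primrec listOf :=
  Primrec.option_getD.comp Primrec.decode (Primrec.const [])

theorem encode_listOf (m : ℕ) : Encodable.encode (listOf m) = m := by
  have h : Encodable.encode (Denumerable.ofNat (List ℕ) m) = m := Denumerable.encode_ofNat m
  conv_lhs => rw [← h]
  rw [listOf_encode, h]

/-- The value at `m` of the function with index `e`, computed with the number of steps that the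
second component of the `m`-th entry of `l` allows. -/
def certVal (e : ℕ) (l : List ℕ) (m : ℕ) : Option ℕ :=
  Code.evaln (l.getD m 0).unpair.2 (Denumerable.ofNat Code e) m

/-- `l` is consistent with being an initial segment of a sequence of pairs whose first
components form a path through `treeAt e` and whose second components witness that `e` decides
a tree. -/
def CertTree (e : ℕ) (l : List ℕ) : Prop :=
  (∀ m < l.length, certVal e l m ≠ none) ∧
  (∀ m < l.length, certVal e l m = some 1 → ∀ j < (listOf m).length,
    Encodable.encode ((listOf m).take j) < l.length →
      certVal e l (Encodable.encode ((listOf m).take j)) = some 1) ∧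
  (∀ k < l.length,
    Encodable.encode ((List.range k).map fun i => (l.getD i 0).unpair.1) < l.length →
      certVal e l (Encodable.encode ((List.range k).map fun i => (l.getD i 0).unpair.1)) = some 1)

theorem primrec_certVal {α : Type} [Primcodable α] {e m : α → ℕ} {l : α → List ℕ}
    (he : Primrec e) (hl : Primrec l) (hm : Primrec m) :
    Primrec fun a => certVal (e a) (l a) (m a) :=
  primrec_evaln_comp
    (Primrec.snd.comp (Primrec.unpair.comp ((Primrec.list_getD 0).comp hl hm)))
    ((Primrec.ofNat Code).comp he) hm

theorem primrecRel_certTree : PrimrecRel CertTree := by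
  have hlen : Primrec fun a : ℕ × List ℕ => a.2.length := Primrec.list_length.comp Primrec.snd
  refine PrimrecPred.and ?_ (PrimrecPred.and ?_ ?_)
  · refine primrecPred_forall_lt hlen (PrimrecPred.not (Primrec.eq.comp ?_ (Primrec.const none)))
    exact primrec_certVal (Primrec.fst.comp Primrec.fst) (Primrec.snd.comp Primrec.fst) Primrec.snd
  · refine primrecPred_forall_lt hlen (primrecPred_imp (Primrec.eq.comp ?_ (Primrec.const _))
      (primrecPred_forall_lt (Primrec.list_length.comp (primrec_listOf.comp Primrec.snd))
        (primrecPred_imp ?_ (Primrec.eq.comp ?_ (Primrec.const _)))))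
    · exact primrec_certVal (Primrec.fst.comp Primrec.fst) (Primrec.snd.comp Primrec.fst)
        Primrec.snd
    · exact Primrec.nat_lt.comp (Primrec.encode.comp (Primrec.list_take.comp Primrec.snd
        (primrec_listOf.comp (Primrec.snd.comp Primrec.fst))))
        (Primrec.list_length.comp (Primrec.snd.comp (Primrec.fst.comp Primrec.fst)))
    · exact primrec_certVal (Primrec.fst.comp (Primrec.fst.comp Primrec.fst))
        (Primrec.snd.comp (Primrec.fst.comp Primrec.fst))
        (Primrec.encode.comp (Primrec.list_take.comp Primrec.snd
          (primrec_listOf.comp (Primrec.snd.comp Primrec.fst))))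
  · have hp : Primrec fun b : (ℕ × List ℕ) × ℕ =>
        (List.range b.2).map fun i => (b.1.2.getD i 0).unpair.1 :=
      primrec_list_map_range Primrec.snd (Primrec.fst.comp (Primrec.unpair.comp
        ((Primrec.list_getD 0).comp (Primrec.snd.comp (Primrec.fst.comp Primrec.fst))
          Primrec.snd)))
    refine primrecPred_forall_lt hlen (primrecPred_imp (Primrec.nat_lt.comp
      (Primrec.encode.comp hp) (Primrec.list_length.comp (Primrec.snd.comp Primrec.fst)))
      (Primrec.eq.comp ?_ (Primrec.const _)))
    exact primrec_certVal (Primrec.fst.comp Primrec.fst) (Primrec.snd.comp Primrec.fst)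
      (Primrec.encode.comp hp)

theorem forall_certTree_iff {e : ℕ} {g : ℕ → ℕ} : (∀ k, CertTree e (initSeg g k)) ↔
    (∀ m, Code.evaln (g m).unpair.2 (Denumerable.ofNat Code e) m ≠ none) ∧
    (∀ l : List ℕ, Code.evaln (g (Encodable.encode l)).unpair.2 (Denumerable.ofNat Code e)
        (Encodable.encode l) = some 1 → ∀ j < l.length,
      Code.evaln (g (Encodable.encode (l.take j))).unpair.2 (Denumerable.ofNat Code e)
        (Encodable.encode (l.take j)) = some 1) ∧
    (∀ k, Code.evaln (g (Encodable.encode (initSeg (fun i => (g i).unpair.1) k))).unpair.2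
        (Denumerable.ofNat Code e)
        (Encodable.encode (initSeg (fun i => (g i).unpair.1) k)) = some 1) := by
  have hval {k m : ℕ} (h : m < k) : certVal e (initSeg g k) m =
      Code.evaln (g m).unpair.2 (Denumerable.ofNat Code e) m := by
    rw [certVal, getD_initSeg _ h]
  have hpath {k m : ℕ} (h : m ≤ k) :
      ((List.range m).map fun i => ((initSeg g k).getD i 0).unpair.1) =
        initSeg (fun i => (g i).unpair.1) m :=
    initSeg_congr fun i hi => by rw [getD_initSeg _ (hi.trans_le h)]
  constructor
  · intro h
    refine ⟨fun m => ?_, fun l hl j hj => ?_, fun k => ?_⟩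
    · have := (h (m + 1)).1 m (by simp)
      rwa [hval (by omega)] at this
    · have := (h (max (Encodable.encode l) (Encodable.encode (l.take j)) + 1)).2.1
        (Encodable.encode l) (by rw [length_initSeg]; omega) (by rwa [hval (by omega)]) j
        (by simpa using hj)
        (by rw [listOf_encode, length_initSeg]; omega)
      rwa [listOf_encode, hval (by omega)] at this
    · have := (h (max k (Encodable.encode (initSeg (fun i => (g i).unpair.1) k)) + 1)).2.2 k
        (by rw [length_initSeg]; omega)
      rw [hpath (by omega), hval (by omega)] at this
      exact this (by rw [length_initSeg]; omega)
  · rintro ⟨h₁, h₂, h₃⟩ k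
    refine ⟨fun m hm => ?_, fun m hm hm' j hj hj' => ?_, fun j hj hj' => ?_⟩
    · rw [length_initSeg] at hm
      rw [hval hm]
      exact h₁ m
    · rw [length_initSeg] at hm hj'
      rw [hval hm] at hm'
      rw [hval hj']
      exact h₂ (listOf m) (by rwa [encode_listOf]) j hj
    · rw [length_initSeg] at hj
      rw [hpath hj.le, length_initSeg] at hj'
      rw [hpath hj.le, hval hj']
      exact h₃ j

theorem mem_treeAt {e : ℕ} {l : List ℕ} (h : DecidesTree e) :
    l ∈ treeAt e ↔ codeFn e (Encodable.encode l) = Part.some 1 := by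
  simp [treeAt, h]

theorem IllFounded.decidesTree {e : ℕ} (h : IllFounded (treeAt e)) : DecidesTree e := by
  by_contra hd
  obtain ⟨f, hf⟩ := h
  simpa [treeAt, hd] using hf 0

theorem isPath_of_certTree {e : ℕ} {g : ℕ → ℕ} (h : ∀ k, CertTree e (initSeg g k)) :
    IsPath (treeAt e) fun n => (g n).unpair.1 := by
  obtain ⟨h₁, h₂, h₃⟩ := forall_certTree_iff.1 h
  have hval {m : ℕ} : codeFn e m = Part.some 1 →
      Code.evaln (g m).unpair.2 (Denumerable.ofNat Code e) m = some 1 := by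
    intro hm
    obtain ⟨x, hx⟩ := Option.ne_none_iff_exists'.1 (h₁ m)
    have hx' : x ∈ codeFn e m := Code.evaln_sound hx
    rw [hm, Part.mem_some_iff] at hx'
    rw [hx, hx']
  have hval' {m : ℕ} (hm : Code.evaln (g m).unpair.2 (Denumerable.ofNat Code e) m = some 1) :
      codeFn e m = Part.some 1 :=
    Part.eq_some_iff.2 (Code.evaln_sound hm)
  have hd : DecidesTree e := by
    refine ⟨fun n => ?_, fun l hl l' hl' => ?_⟩
    · obtain ⟨x, hx⟩ := Option.ne_none_iff_exists'.1 (h₁ n)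
      exact Part.dom_iff_mem.2 ⟨x, Code.evaln_sound hx⟩
    · rcases hl'.length_le.lt_or_eq with hlt | heq
      · have := h₂ l (hval hl) _ hlt
        rw [← List.prefix_iff_eq_take.1 hl'] at this
        exact hval' this
      · rwa [hl'.eq_of_length heq]
  exact fun k => (mem_treeAt hd).2 (hval' (h₃ k))

theorem exists_certTree {e : ℕ} (h : IllFounded (treeAt e)) :
    ∃ g, ∀ k, CertTree e (initSeg g k) := by
  have hd := h.decidesTree
  obtain ⟨f, hf⟩ := h
  have hw (m : ℕ) : ∃ w, ∀ x,
      x ∈ codeFn e m ↔ Code.evaln w (Denumerable.ofNat Code e) m = some x := by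
    obtain ⟨x, hx⟩ := Part.dom_iff_mem.1 (hd.1 m)
    obtain ⟨w, hw⟩ := Code.evaln_complete.1 hx
    exact ⟨w, fun y => ⟨fun hy => Part.mem_unique hx hy ▸ hw, fun hy => Code.evaln_sound hy⟩⟩
  choose w hw using hw
  refine ⟨fun n => Nat.pair (f n) (w n), forall_certTree_iff.2 ?_⟩
  simp only [Nat.unpair_pair]
  refine ⟨fun m hm => ?_, fun l hl j _ => ?_, fun k => ?_⟩
  · obtain ⟨x, hx⟩ := Part.dom_iff_mem.1 (hd.1 m)
    rw [(hw m x).1 hx] at hm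
    cases hm
  · rw [← hw, ← Part.eq_some_iff] at hl ⊢
    exact hd.2 l hl _ ⟨l.drop j, List.take_append_drop j l⟩
  · rw [← hw, ← Part.eq_some_iff]
    exact (mem_treeAt hd).1 (hf k)

/-! ### Self-referential trees -/

theorem exists_treeAt_eq {R : ℕ → List ℕ → Prop} (hR : PrimrecRel R) :
    ∃ e, DecidesTree e ∧ treeAt e = {l | ∀ k < l.length + 1, R e (l.take k)} := by
  classical
  have hp : PrimrecPred fun a : Code × ℕ =>
      ∀ k < (listOf a.2).length + 1, R (Encodable.encode a.1) ((listOf a.2).take k) := by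
    have hl : Primrec fun a : Code × ℕ => listOf a.2 := primrec_listOf.comp Primrec.snd
    exact primrecPred_forall_lt (Primrec.succ.comp (Primrec.list_length.comp hl))
      (hR.comp (Primrec.encode.comp (Primrec.fst.comp Primrec.fst))
        (Primrec.list_take.comp Primrec.snd (hl.comp Primrec.fst)))
  have hq : Primrec₂ fun (c : Code) (n : ℕ) =>
      if ∀ k < (listOf n).length + 1, R (Encodable.encode c) ((listOf n).take k) then 1 else 0 :=
    Primrec.ite hp (Primrec.const 1) (Primrec.const 0)
  obtain ⟨c, hc⟩ := Code.fixed_point₂ hq.to_comp.partrec₂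
  have hfn (n : ℕ) : codeFn (Encodable.encode c) n = Part.some
      (if ∀ k < (listOf n).length + 1, R (Encodable.encode c) ((listOf n).take k)
        then 1 else 0) := by
    rw [codeFn, Denumerable.ofNat_encode, hc]
    rfl
  have hmem (l : List ℕ) : codeFn (Encodable.encode c) (Encodable.encode l) = Part.some 1 ↔
      ∀ k < l.length + 1, R (Encodable.encode c) (l.take k) := by
    rw [hfn, listOf_encode, Part.some_inj]
    split_ifs with h
    · exact iff_of_true rfl h
    · exact iff_of_false (by decide) h
  have hd : DecidesTree (Encodable.encode c) := by
    refine ⟨fun n => by rw [hfn]; trivial, fun l hl l' hl' => ?_⟩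
    rw [Set.mem_ofPred_eq, hmem] at hl ⊢
    intro k hk
    have := hl k (by have := hl'.length_le; omega)
    rwa [List.prefix_iff_eq_take.1 hl', List.take_take, min_eq_left (by omega)]
  exact ⟨_, hd, Set.ext fun l => (mem_treeAt hd).trans (hmem l)⟩

theorem illFounded_of_treeAt_eq {R : ℕ → List ℕ → Prop} {e : ℕ}
    (he : treeAt e = {l | ∀ k < l.length + 1, R e (l.take k)}) :
    IllFounded (treeAt e) ↔ ∃ f, ∀ k, R e (initSeg f k) := by
  refine exists_congr fun f => isPath_iff.trans ⟨fun h k => ?_, fun h k => ?_⟩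
  · have := h k
    rw [he] at this
    simpa [take_initSeg] using this k (by simp)
  · rw [he]
    intro j _
    rw [take_initSeg]
    exact h _

/-! ### The use principle -/

open Filter in
/-- `G` approximates `f` from the finite initial segments of the oracle `O`. -/
structure Approximates (O : ℕ → ℕ) (G : List ℕ → ℕ →. ℕ) (f : ℕ →. ℕ) : Prop where
  sound : ∀ n k, ∀ v ∈ G (initSeg O k) n, v ∈ f n
  complete : ∀ n, ∀ v ∈ f n, ∀ᶠ k in atTop, v ∈ G (initSeg O k) n

theorem exists_approximates_of_partrec (O : ℕ → ℕ) {f : ℕ →. ℕ} (hf : Nat.Partrec f) :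
    ∃ G, Partrec₂ G ∧ Approximates O G f :=
  ⟨fun _ => f, ((Partrec.nat_iff.2 hf).comp Computable.snd).to₂, fun _ _ _ => id,
    fun _ _ h => .of_forall fun _ => h⟩

open Filter in
theorem RecursiveIn.exists_approximates {O : ℕ → ℕ} {f : ℕ →. ℕ} (hf : RecursiveIn O f) :
    ∃ G, Partrec₂ G ∧ Approximates O G f := by
  induction hf with
  | zero => exact exists_approximates_of_partrec O .zero
  | succ => exact exists_approximates_of_partrec O .succ
  | left => exact exists_approximates_of_partrec O .left
  | right => exact exists_approximates_of_partrec O .right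
  | oracle =>
    refine ⟨fun l n => Part.ofOption l[n]?, Computable.ofOption Primrec.list_getElem?.to_comp,
      fun n k v hv => ?_, fun n v hv => ?_⟩
    · by_cases h : n < k
      · rw [getElem?_initSeg O h] at hv
        simpa using hv
      · rw [List.getElem?_eq_none (by simpa using h)] at hv
        simp at hv
    · filter_upwards [eventually_gt_atTop n] with k hk
      rw [getElem?_initSeg O hk]
      simpa using hv
  | @pair f g _ _ ihf ihg =>
    obtain ⟨F, hF, aF⟩ := ihf
    obtain ⟨G, hG, aG⟩ := ihg
    refine ⟨fun l n => (F l n).bind fun a => (G l n).map fun b => Nat.pair a b, ?_, ?_, ?_⟩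
    · exact hF.bind (Partrec.map (hG.comp (Computable.fst.comp Computable.fst)
        (Computable.snd.comp Computable.fst)) (Primrec₂.natPair.to_comp.comp
          (Computable.snd.comp Computable.fst) Computable.snd))
    · intro n k v hv
      simp only [Part.mem_bind_iff, Part.mem_map_iff] at hv
      obtain ⟨a, ha, b, hb, rfl⟩ := hv
      simp only [Seq.seq, Part.map_eq_map, Part.mem_bind_iff, Part.mem_map_iff]
      exact ⟨_, ⟨a, aF.sound _ _ _ ha, rfl⟩, b, aG.sound _ _ _ hb, rfl⟩
    · intro n v hv
      simp only [Seq.seq, Part.map_eq_map, Part.mem_bind_iff, Part.mem_map_iff] at hv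
      obtain ⟨_, ⟨a, ha, rfl⟩, b, hb, rfl⟩ := hv
      filter_upwards [aF.complete _ _ ha, aG.complete _ _ hb] with k hka hkb
      simp only [Part.mem_bind_iff, Part.mem_map_iff]
      exact ⟨a, hka, b, hkb, rfl⟩
  | @comp f g _ _ ihf ihg =>
    obtain ⟨F, hF, aF⟩ := ihf
    obtain ⟨G, hG, aG⟩ := ihg
    refine ⟨fun l n => (G l n).bind (F l), ?_, ?_, ?_⟩
    · exact hG.bind (hF.comp (Computable.fst.comp Computable.fst) Computable.snd)
    · intro n k v hv
      obtain ⟨a, ha, hb⟩ := Part.mem_bind_iff.1 hv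
      exact Part.mem_bind_iff.2 ⟨a, aG.sound _ _ _ ha, aF.sound _ _ _ hb⟩
    · intro n v hv
      obtain ⟨a, ha, hb⟩ := Part.mem_bind_iff.1 hv
      filter_upwards [aG.complete _ _ ha, aF.complete _ _ hb] with k hka hkb
      exact Part.mem_bind_iff.2 ⟨a, hka, hkb⟩
  | @prec f g _ _ ihf ihg =>
    obtain ⟨F, hF, aF⟩ := ihf
    obtain ⟨G, hG, aG⟩ := ihg
    refine ⟨fun l n => n.unpair.2.rec (F l n.unpair.1) fun y IH =>
      IH.bind fun i => G l (Nat.pair n.unpair.1 (Nat.pair y i)), ?_, ?_, ?_⟩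
    · have hu : Computable fun a : List ℕ × ℕ => a.2.unpair :=
        Computable.unpair.comp Computable.snd
      exact Partrec.nat_rec (Computable.snd.comp hu)
        (hF.comp Computable.fst (Computable.fst.comp hu))
        (hG.comp (Computable.fst.comp Computable.fst)
          (Primrec₂.natPair.to_comp.comp (Computable.fst.comp (hu.comp Computable.fst))
            (Primrec₂.natPair.to_comp.comp (Computable.fst.comp Computable.snd)
              (Computable.snd.comp Computable.snd)))).to₂
    · intro n k
      rw [← Nat.pair_unpair n]
      generalize n.unpair.1 = a
      generalize n.unpair.2 = m
      simp only [Nat.unpaired, Nat.unpair_pair]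
      induction m with
      | zero => exact aF.sound _ _
      | succ y ih =>
        intro v hv
        obtain ⟨i, hi, hv⟩ := Part.mem_bind_iff.1 hv
        exact Part.mem_bind_iff.2 ⟨i, ih _ hi, aG.sound _ _ _ hv⟩
    · intro n
      rw [← Nat.pair_unpair n]
      generalize n.unpair.1 = a
      generalize n.unpair.2 = m
      simp only [Nat.unpaired, Nat.unpair_pair]
      induction m with
      | zero => exact aF.complete _
      | succ y ih =>
        intro v hv
        obtain ⟨i, hi, hv⟩ := Part.mem_bind_iff.1 hv
        filter_upwards [ih _ hi, aG.complete _ _ hv] with k hki hkv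
        exact Part.mem_bind_iff.2 ⟨i, hki, hkv⟩
  | @rfind f _ ihf =>
    obtain ⟨F, hF, aF⟩ := ihf
    refine ⟨fun l n => Nat.rfind fun m => (F l (Nat.pair n m)).map fun v => decide (v = 0),
      ?_, ?_, ?_⟩
    · refine Partrec.rfind (Partrec.map (hF.comp (Computable.fst.comp Computable.fst)
        (Primrec₂.natPair.to_comp.comp (Computable.snd.comp Computable.fst) Computable.snd)) ?_)
      exact ((Primrec.eq.comp Primrec.snd (Primrec.const 0)).decide).to_comp
    · intro n k v hv
      obtain ⟨h₁, h₂⟩ := Nat.mem_rfind.1 hv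
      refine Nat.mem_rfind.2 ⟨?_, fun hm => ?_⟩
      · obtain ⟨a, ha, ha0⟩ := (Part.mem_map_iff _).1 h₁
        exact (Part.mem_map_iff _).2 ⟨a, aF.sound _ _ _ ha, ha0⟩
      · obtain ⟨a, ha, ha0⟩ := (Part.mem_map_iff _).1 (h₂ hm)
        exact (Part.mem_map_iff _).2 ⟨a, aF.sound _ _ _ ha, ha0⟩
    · intro n v hv
      obtain ⟨h₁, h₂⟩ := Nat.mem_rfind.1 hv
      obtain ⟨a, ha, ha0⟩ := (Part.mem_map_iff _).1 h₁
      have hall : ∀ᶠ k in atTop, ∀ m ∈ Finset.range v,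
          false ∈ (F (initSeg O k) (Nat.pair n m)).map fun v => decide (v = 0) := by
        rw [Filter.eventually_all_finset]
        intro m hm
        obtain ⟨b, hb, hb0⟩ := (Part.mem_map_iff _).1 (h₂ (Finset.mem_range.1 hm))
        filter_upwards [aF.complete _ _ hb] with k hk
        exact (Part.mem_map_iff _).2 ⟨b, hk, hb0⟩
      filter_upwards [aF.complete _ _ ha, hall] with k hka hk
      exact Nat.mem_rfind.2 ⟨(Part.mem_map_iff _).2 ⟨a, hka, ha0⟩,
        fun h => hk _ (Finset.mem_range.2 h)⟩

theorem RecursiveIn.of_partrec {O : ℕ → ℕ} {f : ℕ →. ℕ} (hf : Nat.Partrec f) :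
    RecursiveIn O f := by
  induction hf with
  | zero => exact .zero
  | succ => exact .succ
  | left => exact .left
  | right => exact .right
  | pair _ _ hf hg => exact hf.pair hg
  | comp _ _ hf hg => exact hf.comp hg
  | prec _ _ hf hg => exact hf.prec hg
  | rfind _ hf => exact hf.rfind

/-- The functional with code `c`, acting on finite oracles. -/
def finEval (c : Code) (l : List ℕ) (n : ℕ) : Part ℕ := c.eval (Encodable.encode (l, n))

theorem RecursiveIn.exists_finEval {O : ℕ → ℕ} {f : ℕ →. ℕ} (hf : RecursiveIn O f) :
    ∃ c, Approximates O (finEval c) f := by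
  obtain ⟨G, hG, aG⟩ := hf.exists_approximates
  have hG' : Nat.Partrec fun n => Part.bind (Part.ofOption (Encodable.decode (α := List ℕ × ℕ) n))
      fun a => (G a.1 a.2).map Encodable.encode := hG
  obtain ⟨c, hc⟩ := Code.exists_code.1 hG'
  have : finEval c = G := by
    funext l n
    rw [finEval, hc]
    simp [Part.map_id']
  exact ⟨c, this ▸ aG⟩

/-! ### Forcing conditions

A position `Nat.pair (Nat.pair e n) (Nat.pair v j)` of the generic set stands for the assertion
that the `n`-th entry of the certified path chosen for index `e` is `v`. -/

/-- The family `G` of sequences permits the value `v` at position `m`. -/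
def Permits (G : ℕ → ℕ) (m v : ℕ) : Prop :=
  v = 0 ∨ v = 1 ∧ G m.unpair.1 = m.unpair.2.unpair.1 ∧
    ∀ k, CertTree m.unpair.1.unpair.1 (initSeg (fun i => G (Nat.pair m.unpair.1.unpair.1 i)) k)

/-- A forcing condition: a finite string permitted by some family of sequences. -/
def Cond (σ : List ℕ) : Prop := ∃ G, ∀ m < σ.length, Permits G m (σ.getD m 0)

/-- The part of `Permits G m v` that can be checked on the initial segment `l` of `G`. -/
def FinPermits (l : List ℕ) (m v : ℕ) : Prop :=
  v = 0 ∨ v = 1 ∧ (m.unpair.1 < l.length → l.getD m.unpair.1 0 = m.unpair.2.unpair.1) ∧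
    ∀ k < l.length, Nat.pair m.unpair.1.unpair.1 k < l.length →
      CertTree m.unpair.1.unpair.1
        ((List.range k).map fun i => l.getD (Nat.pair m.unpair.1.unpair.1 i) 0)

theorem forall_finPermits_iff {G : ℕ → ℕ} {m v : ℕ} :
    (∀ k, FinPermits (initSeg G k) m v) ↔ Permits G m v := by
  have hcol {e j k : ℕ} (h : Nat.pair e j < k) :
      ((List.range j).map fun i => (initSeg G k).getD (Nat.pair e i) 0) =
        initSeg (fun i => G (Nat.pair e i)) j :=
    initSeg_congr fun i hi => getD_initSeg _ ((Nat.pair_lt_pair_right e hi).trans h) 0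
  constructor
  · intro h
    by_cases hv : v = 0
    · exact .inl hv
    refine .inr ⟨((h 0).resolve_left hv).1, ?_, fun k => ?_⟩
    · have := ((h (m.unpair.1 + 1)).resolve_left hv).2.1 (by simp)
      rwa [getD_initSeg _ (by omega)] at this
    · have := ((h (max k (Nat.pair m.unpair.1.unpair.1 k) + 1)).resolve_left hv).2.2 k
        (by rw [length_initSeg]; omega) (by rw [length_initSeg]; omega)
      rwa [hcol (by omega)] at this
  · rintro (h | ⟨h₁, h₂, h₃⟩) k
    · exact .inl h
    refine .inr ⟨h₁, fun hm => ?_, fun j _ hj => ?_⟩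
    · rw [getD_initSeg _ (by simpa using hm), h₂]
    · rw [hcol (by simpa using hj)]
      exact h₃ j

theorem primrecPred_finPermits {α : Type} [Primcodable α] {l : α → List ℕ} {m v : α → ℕ}
    (hl : Primrec l) (hm : Primrec m) (hv : Primrec v) :
    PrimrecPred fun a => FinPermits (l a) (m a) (v a) := by
  have hmu := Primrec.unpair.comp hm
  have he : Primrec fun a => (m a).unpair.1.unpair.1 :=
    Primrec.fst.comp (Primrec.unpair.comp (Primrec.fst.comp hmu))
  have hlen := Primrec.list_length.comp hl
  refine (Primrec.eq.comp hv (Primrec.const 0)).or ((Primrec.eq.comp hv (Primrec.const 1)).and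
    (PrimrecPred.and ?_ ?_))
  · exact primrecPred_imp (Primrec.nat_lt.comp (Primrec.fst.comp hmu) hlen)
      (Primrec.eq.comp ((Primrec.list_getD 0).comp hl (Primrec.fst.comp hmu))
        (Primrec.fst.comp (Primrec.unpair.comp (Primrec.snd.comp hmu))))
  · refine primrecPred_forall_lt hlen (primrecPred_imp (Primrec.nat_lt.comp
      (Primrec₂.natPair.comp (he.comp Primrec.fst) Primrec.snd) (hlen.comp Primrec.fst))
      (primrecRel_certTree.comp (he.comp Primrec.fst) (primrec_list_map_range Primrec.snd ?_)))
    exact (Primrec.list_getD 0).comp (hl.comp (Primrec.fst.comp Primrec.fst))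
      (Primrec₂.natPair.comp (he.comp (Primrec.fst.comp Primrec.fst)) Primrec.snd)

theorem getD_of_isPrefix {τ σ : List ℕ} (h : τ <+: σ) {m : ℕ} (hm : m < τ.length) :
    σ.getD m 0 = τ.getD m 0 := by
  obtain ⟨ρ, rfl⟩ := h
  exact List.getD_append _ _ _ _ hm

theorem Cond.of_isPrefix {τ σ : List ℕ} (hσ : Cond σ) (h : τ <+: σ) : Cond τ := by
  obtain ⟨G, hG⟩ := hσ
  refine ⟨G, fun m hm => ?_⟩
  rw [← getD_of_isPrefix h hm]
  exact hG m (hm.trans_le h.length_le)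

theorem Cond.append_zero {σ : List ℕ} (hσ : Cond σ) : Cond (σ ++ [0]) := by
  obtain ⟨G, hG⟩ := hσ
  refine ⟨G, fun m hm => ?_⟩
  by_cases h : m < σ.length
  · rw [List.getD_append _ _ _ _ h]
    exact hG m h
  · rw [List.length_append, List.length_singleton] at hm
    obtain rfl : m = σ.length := by omega
    exact .inl (by simp)

/-- Every condition can be extended so as to decide the `n`-th entry of the path for `e`. -/
theorem Cond.exists_extension {τ : List ℕ} (hτ : Cond τ) {e : ℕ} (he : IllFounded (treeAt e))
    (n : ℕ) : ∃ σ, Cond σ ∧ τ <+: σ ∧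
      ∃ t, Nat.pair (Nat.pair e n) t < σ.length ∧ σ.getD (Nat.pair (Nat.pair e n) t) 0 = 1 := by
  obtain ⟨G, hG, hGe⟩ : ∃ G, (∀ m < τ.length, Permits G m (τ.getD m 0)) ∧
      ∀ k, CertTree e (initSeg (fun i => G (Nat.pair e i)) k) := by
    obtain ⟨G, hG⟩ := hτ
    by_cases h : ∀ k, CertTree e (initSeg (fun i => G (Nat.pair e i)) k)
    · exact ⟨G, hG, h⟩
    obtain ⟨g, hg⟩ := exists_certTree he
    refine ⟨fun i => if i.unpair.1 = e then g i.unpair.2 else G i, fun m hm => ?_, by simpa⟩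
    rcases hG m hm with h₀ | ⟨h₁, h₂, h₃⟩
    · exact .inl h₀
    · have hne : m.unpair.1.unpair.1 ≠ e := by
        rintro rfl
        exact h h₃
      exact .inr ⟨h₁, by simpa [hne] using h₂, by simpa [hne] using h₃⟩
  set m := Nat.pair (Nat.pair e n) (Nat.pair (G (Nat.pair e n)) τ.length) with hm
  have hle : τ.length ≤ m := (Nat.right_le_pair _ _).trans (Nat.right_le_pair _ _)
  set s : ℕ → ℕ := fun i => if i < τ.length then τ.getD i 0 else if i = m then 1 else 0 with hs
  refine ⟨initSeg s (m + 1), ⟨G, fun i hi => ?_⟩, ?_, Nat.pair (G (Nat.pair e n)) τ.length, ?_, ?_⟩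
  · rw [length_initSeg] at hi
    rw [getD_initSeg _ hi]
    by_cases h : i < τ.length
    · simpa only [hs, h, if_true] using hG i h
    · by_cases h' : i = m
      · refine .inr ⟨by simp only [hs, h, if_pos h', if_false], ?_⟩
        subst h'
        simpa [hm] using hGe
      · exact .inl (by simp [hs, h, h'])
  · have : τ = initSeg s τ.length :=
      (eq_initSeg τ).trans (initSeg_congr fun i hi => by simp only [hs, hi, if_true])
    rw [this]
    simpa using initSeg_isPrefix s (show τ.length ≤ m + 1 by omega)
  · rw [length_initSeg]
    omega
  · rw [getD_initSeg _ (by omega)]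
    simp only [hs, ← hm, hle.not_gt, if_true, if_false]

/-! ### Diagonalization against a functional -/

/-- `σ` is a condition extending `τ` relative to which the functional with code `c` computes,
at index `e`, the string `l`, which does not belong to `treeAt e`. -/
structure Refutes (c : Code) (τ : List ℕ) (e : ℕ) (σ l : List ℕ) : Prop where
  le : τ <+: σ
  cond : Cond σ
  eval : ∀ i < l.length, l.getD i 0 ∈ finEval c σ (Nat.pair e i)
  notMem : l ∉ treeAt e

/-- The triple of two lists and a number coded by a natural number. -/
def tripleOf (h : ℕ) : List ℕ × List ℕ × ℕ := (Encodable.decode h).getD ([], [], 0)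

/-- The part of `Refutes c τ e p.1 p.2.1` other than `Cond p.1`, with computations bounded by
`p.2.2` steps. -/
def BoundedRefutes (c : Code) (τ : List ℕ) (e : ℕ) (p : List ℕ × List ℕ × ℕ) : Prop :=
  p.1.take τ.length = τ ∧
  (∀ i < p.2.1.length,
    Code.evaln p.2.2 c (Encodable.encode (p.1, Nat.pair e i)) = some (p.2.1.getD i 0)) ∧
  Code.evaln p.2.2 (Denumerable.ofNat Code e) (Encodable.encode p.2.1) ≠ none ∧
  Code.evaln p.2.2 (Denumerable.ofNat Code e) (Encodable.encode p.2.1) ≠ some 1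

/-- `l` is consistent with coding a string refuted at `e`, followed by a family permitting the
corresponding condition. -/
def DiagTree (c : Code) (τ : List ℕ) (e : ℕ) (l : List ℕ) : Prop :=
  l = [] ∨ BoundedRefutes c τ e (tripleOf l.headI) ∧
    ∀ m < (tripleOf l.headI).1.length, FinPermits l.tail m ((tripleOf l.headI).1.getD m 0)

theorem primrecRel_boundedRefutes (c : Code) (τ : List ℕ) :
    PrimrecRel (BoundedRefutes c τ) := by
  have h₁ : Primrec fun a : ℕ × List ℕ × List ℕ × ℕ => a.2.1 := Primrec.fst.comp Primrec.snd
  have h₂ : Primrec fun a : ℕ × List ℕ × List ℕ × ℕ => a.2.2.1 :=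
    Primrec.fst.comp (Primrec.snd.comp Primrec.snd)
  have h₃ : Primrec fun a : ℕ × List ℕ × List ℕ × ℕ => a.2.2.2 :=
    Primrec.snd.comp (Primrec.snd.comp Primrec.snd)
  have hev := primrec_evaln_comp h₃ ((Primrec.ofNat Code).comp Primrec.fst)
    (Primrec.encode.comp h₂)
  refine (Primrec.eq.comp (Primrec.list_take.comp (Primrec.const _) h₁) (Primrec.const τ)).and
    (PrimrecPred.and ?_ ((Primrec.eq.comp hev (Primrec.const _)).not.and
      (Primrec.eq.comp hev (Primrec.const _)).not))
  refine primrecPred_forall_lt (Primrec.list_length.comp h₂) (Primrec.eq.comp ?_ ?_)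
  · exact primrec_evaln_comp (h₃.comp Primrec.fst) (Primrec.const c)
      (Primrec.encode.comp ((h₁.comp Primrec.fst).pair
        (Primrec₂.natPair.comp (Primrec.fst.comp Primrec.fst) Primrec.snd)))
  · exact Primrec.option_some.comp ((Primrec.list_getD 0).comp (h₂.comp Primrec.fst) Primrec.snd)

theorem primrecRel_diagTree (c : Code) (τ : List ℕ) : PrimrecRel (DiagTree c τ) := by
  have ht : Primrec fun a : ℕ × List ℕ => tripleOf a.2.headI :=
    (Primrec.option_getD.comp Primrec.decode (Primrec.const _)).comp
      (Primrec.list_headI.comp Primrec.snd)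
  have hσ := Primrec.fst.comp ht
  exact (Primrec.eq.comp Primrec.snd (Primrec.const [])).or
    (((primrecRel_boundedRefutes c τ).comp Primrec.fst ht).and
      (primrecPred_forall_lt (Primrec.list_length.comp hσ)
        (primrecPred_finPermits (Primrec.list_tail.comp (Primrec.snd.comp Primrec.fst))
          Primrec.snd ((Primrec.list_getD 0).comp (hσ.comp Primrec.fst) Primrec.snd))))

open Filter in
theorem eventually_mem_evaln {c : Code} {n v : ℕ} (h : v ∈ c.eval n) :
    ∀ᶠ s in atTop, Code.evaln s c n = some v := by
  obtain ⟨s, hs⟩ := Code.evaln_complete.1 h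
  filter_upwards [eventually_ge_atTop s] with t ht
  exact Code.evaln_mono ht hs

theorem exists_diagTree_iff {c : Code} {τ : List ℕ} {e : ℕ} (hd : DecidesTree e) :
    (∃ f, ∀ k, DiagTree c τ e (initSeg f k)) ↔ ∃ σ l, Refutes c τ e σ l := by
  constructor
  · rintro ⟨f, hf⟩
    have hf' (k : ℕ) := (hf (k + 1)).resolve_left (by rw [initSeg_succ_cons]; simp)
    simp only [initSeg_succ_cons, List.headI_cons, List.tail_cons] at hf'
    obtain ⟨h₁, h₂, h₃, h₄⟩ := (hf' 0).1
    refine ⟨(tripleOf (f 0)).1, (tripleOf (f 0)).2.1, List.prefix_iff_eq_take.2 h₁.symm,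
      ⟨fun i => f (i + 1), fun m hm => forall_finPermits_iff.1 fun k => (hf' k).2 m hm⟩,
      fun i hi => Code.evaln_sound (h₂ i hi), fun hmem => ?_⟩
    obtain ⟨x, hx⟩ := Option.ne_none_iff_exists'.1 h₃
    have hx' : x ∈ codeFn e _ := Code.evaln_sound hx
    rw [(mem_treeAt hd).1 hmem, Part.mem_some_iff] at hx'
    exact h₄ (hx' ▸ hx)
  · rintro ⟨σ, l, h⟩
    obtain ⟨x, hx⟩ := Part.dom_iff_mem.1 (hd.1 (Encodable.encode l))
    have hev : ∀ᶠ s in Filter.atTop, ∀ i ∈ Finset.range l.length,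
        Code.evaln s c (Encodable.encode (σ, Nat.pair e i)) = some (l.getD i 0) :=
      (Filter.eventually_all_finset _).2 fun i hi =>
        eventually_mem_evaln (h.eval i (Finset.mem_range.1 hi))
    obtain ⟨s, hs, hsx⟩ := (hev.and (eventually_mem_evaln hx)).exists
    obtain ⟨G, hG⟩ := h.cond
    have htriple : tripleOf (Encodable.encode (σ, l, s)) = (σ, l, s) := by simp [tripleOf]
    refine ⟨fun n => n.casesOn (Encodable.encode (σ, l, s)) G, fun k => ?_⟩
    cases k with
    | zero => exact .inl rfl
    | succ k =>
      rw [initSeg_succ_cons]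
      change DiagTree c τ e (Encodable.encode (σ, l, s) :: initSeg G k)
      rw [DiagTree, List.headI_cons, List.tail_cons, htriple]
      refine .inr ⟨⟨(List.prefix_iff_eq_take.1 h.le).symm,
        fun i hi => hs i (Finset.mem_range.2 hi), ?_, fun h₁ => h.notMem ?_⟩,
        fun m hm => forall_finPermits_iff.2 (hG m hm) k⟩
      · rw [hsx]
        exact Option.some_ne_none x
      · exact (mem_treeAt hd).2 (Part.eq_some_iff.2 (Code.evaln_sound h₁))

/-- Below `σ`, the functional with code `c` does not witness loquacious highness. -/
def ForcesNotLoq (c : Code) (σ : List ℕ) : Prop :=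
  ∀ X : Set ℕ, (∀ k, Cond (initSeg (chi X) k)) → initSeg (chi X) σ.length = σ →
    ∀ F : ℕ × ℕ → ℕ, Approximates (chi X) (finEval c) (fun n => Part.some (F n.unpair)) →
      ∃ e, IllFounded (treeAt e) ∧ ¬ IsPath (treeAt e) fun n => F (e, n)

theorem Cond.exists_forcesNotLoq {τ : List ℕ} (hτ : Cond τ) (c : Code) :
    ∃ σ, Cond σ ∧ τ <+: σ ∧ ForcesNotLoq c σ := by
  obtain ⟨e, hd, he⟩ := exists_treeAt_eq (primrecRel_diagTree c τ)
  have hill : IllFounded (treeAt e) ↔ ∃ σ l, Refutes c τ e σ l :=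
    (illFounded_of_treeAt_eq he).trans (exists_diagTree_iff hd)
  by_cases h : ∃ σ l, Refutes c τ e σ l
  · have ⟨σ, l, hr⟩ := h
    refine ⟨σ, hr.cond, hr.le, fun X _ hX F hF => ⟨e, hill.2 h, fun hp => hr.notMem ?_⟩⟩
    have : l = initSeg (fun n => F (e, n)) l.length := by
      refine (eq_initSeg l).trans (initSeg_congr fun i hi => ?_)
      have := hF.sound (Nat.pair e i) σ.length (l.getD i 0) (by rw [hX]; exact hr.eval i hi)
      simpa using this
    rw [this]
    exact hp _
  · refine ⟨τ, hτ, List.prefix_rfl, fun X hX hXτ F hF => absurd ?_ h⟩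
    have hnp : ¬ IsPath (treeAt e) fun n => F (e, n) := fun hp => h (hill.1 ⟨_, hp⟩)
    rw [isPath_iff, not_forall] at hnp
    obtain ⟨k, hk⟩ := hnp
    have hev : ∀ᶠ N in Filter.atTop, ∀ i ∈ Finset.range k,
        F (e, i) ∈ finEval c (initSeg (chi X) N) (Nat.pair e i) :=
      (Filter.eventually_all_finset _).2 fun i _ => hF.complete _ _ (by simp)
    obtain ⟨N, hN, hτN⟩ := (hev.and (Filter.eventually_ge_atTop τ.length)).exists
    refine ⟨initSeg (chi X) N, _, ?_, hX N, fun i hi => ?_, hk⟩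
    · rw [← hXτ]
      exact initSeg_isPrefix _ hτN
    · rw [length_initSeg] at hi
      rw [getD_initSeg _ hi]
      exact hN i (Finset.mem_range.2 hi)

/-! ### Generic sets -/

theorem exists_generic {ι : Type} [Denumerable ι] {D : ι → List ℕ → Prop}
    (hD : ∀ i τ, Cond τ → ∃ σ, Cond σ ∧ τ <+: σ ∧ D i σ) :
    ∃ X : Set ℕ, (∀ k, Cond (initSeg (chi X) k)) ∧
      ∀ i, ∃ σ, initSeg (chi X) σ.length = σ ∧ D i σ := by
  choose! next hcond hle hnext using hD
  let s : ℕ → List ℕ := fun n => Nat.rec [] (fun n τ => next (Denumerable.ofNat ι n) τ ++ [0]) n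
  have hs_succ (n : ℕ) : s (n + 1) = next (Denumerable.ofNat ι n) (s n) ++ [0] := rfl
  have hs (n : ℕ) : Cond (s n) := by
    induction n with
    | zero => exact ⟨0, fun m hm => absurd hm (Nat.not_lt_zero m)⟩
    | succ n ih => exact (hcond _ _ ih).append_zero
  have hstep (n : ℕ) : s n <+: s (n + 1) := (hle _ _ (hs n)).trans (List.prefix_append _ _)
  have hmono {m n : ℕ} (h : m ≤ n) : s m <+: s n := by
    induction n, h using Nat.le_induction with
    | base => exact List.prefix_rfl
    | succ n _ ih => exact ih.trans (hstep n)
  have hlen (n : ℕ) : n ≤ (s n).length := by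
    induction n with
    | zero => exact Nat.zero_le _
    | succ n ih =>
      have := (hle (Denumerable.ofNat ι n) _ (hs n)).length_le
      rw [hs_succ, List.length_append, List.length_singleton]
      omega
  let X : Set ℕ := {m | ∃ n, (s n).getD m 0 = 1}
  have hX (n : ℕ) : initSeg (chi X) (s n).length = s n := by
    refine Eq.trans (initSeg_congr fun m hm => ?_) (eq_initSeg (s n)).symm
    have hval : (∃ j, (s j).getD m 0 = 1) ↔ (s n).getD m 0 = 1 := by
      refine ⟨fun ⟨j, hj⟩ => ?_, fun h => ⟨n, h⟩⟩
      rcases le_total j n with h | h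
      · rwa [getD_of_isPrefix (hmono h)]
        by_contra hlt
        rw [List.getD_eq_default _ _ (not_lt.1 hlt)] at hj
        cases hj
      · rwa [getD_of_isPrefix (hmono h) hm] at hj
    obtain ⟨G, hG⟩ := hs n
    have hmem : m ∈ X ↔ (s n).getD m 0 = 1 := hval
    rcases hG m hm with h | h
    · rw [h] at hmem ⊢
      simp [chi, hmem]
    · rw [h.1] at hmem ⊢
      simp [chi, hmem]
  have hseg {σ : List ℕ} {n : ℕ} (h : σ <+: s n) : initSeg (chi X) σ.length = σ := by
    conv_rhs => rw [List.prefix_iff_eq_take.1 h, ← hX n, take_initSeg, min_eq_left h.length_le]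
  refine ⟨X, fun k => (hs k).of_isPrefix ?_, fun i => ?_⟩
  · rw [← hX k]
    exact initSeg_isPrefix _ (hlen k)
  · refine ⟨next i (s (Encodable.encode i)), hseg (n := Encodable.encode i + 1) ?_,
      hnext _ _ (hs _)⟩
    rw [hs_succ, Denumerable.ofNat_encode]
    exact List.prefix_append _ _

/-! ### Reading off paths from a generic set -/

theorem chi_eq_one {X : Set ℕ} {m : ℕ} : chi X m = 1 ↔ m ∈ X := by
  simp [chi]

theorem one_sub_chi_eq_zero {X : Set ℕ} {m : ℕ} : 1 - chi X m = 0 ↔ m ∈ X := by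
  by_cases h : m ∈ X <;> simp [chi, h]

/-- Search `X` for an entry of the certified path for `a.1` and return its first component. -/
noncomputable def readPath (X : Set ℕ) (a : ℕ × ℕ) : Part ℕ :=
  (Nat.rfind fun t => Part.some (decide (1 - chi X (Nat.pair (Nat.pair a.1 a.2) t) = 0))).map
    fun t => t.unpair.1.unpair.1

theorem partrecIn_readPath (X : Set ℕ) : PartrecIn (chi X) (readPath X) := by
  have hsub : Nat.Partrec (fun v : ℕ => (1 - v : ℕ) : ℕ → ℕ) :=
    Partrec.nat_iff.1 (Primrec.nat_sub.comp (Primrec.const 1) Primrec.id).to_comp.partrec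
  have hout : Nat.Partrec (fun t : ℕ => t.unpair.1.unpair.1 : ℕ → ℕ) :=
    Partrec.nat_iff.1 (Primrec.fst.comp (Primrec.unpair.comp
      (Primrec.fst.comp Primrec.unpair))).to_comp.partrec
  have h := (RecursiveIn.of_partrec (O := chi X) hout).comp
    ((RecursiveIn.of_partrec hsub).comp .oracle).rfind
  unfold PartrecIn
  refine cast (congrArg (RecursiveIn (chi X)) (funext fun n => ?_)) h
  change ((Nat.rfind fun t => ((Part.some (chi X (Nat.pair n t))).bind fun v =>
    Part.some (1 - v)).map fun m => decide (m = 0)).bind fun t =>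
      Part.some t.unpair.1.unpair.1) = _
  simp [readPath, Part.map_id', ← Part.bind_some_eq_map]

theorem Cond.exists_family {X : Set ℕ} {N : ℕ} (h : Cond (initSeg (chi X) N)) :
    ∃ G : ℕ → ℕ, ∀ e n t, Nat.pair (Nat.pair e n) t < N → Nat.pair (Nat.pair e n) t ∈ X →
      G (Nat.pair e n) = t.unpair.1 ∧ ∀ k, CertTree e (initSeg (fun i => G (Nat.pair e i)) k) := by
  obtain ⟨G, hG⟩ := h
  refine ⟨G, fun e n t hN hX => ?_⟩
  have := hG _ (by rwa [length_initSeg])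
  rw [getD_initSeg _ hN, chi_eq_one.2 hX] at this
  simpa [Permits] using this

theorem illFounded_of_mem {X : Set ℕ} (hX : ∀ k, Cond (initSeg (chi X) k)) {e n t : ℕ}
    (h : Nat.pair (Nat.pair e n) t ∈ X) : IllFounded (treeAt e) := by
  obtain ⟨G, hG⟩ := (hX (Nat.pair (Nat.pair e n) t + 1)).exists_family
  exact ⟨_, isPath_of_certTree (hG e n t (Nat.lt_succ_self _) h).2⟩

theorem isPath_of_mem {X : Set ℕ} (hX : ∀ k, Cond (initSeg (chi X) k)) {e : ℕ} {t : ℕ → ℕ}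
    (h : ∀ n, Nat.pair (Nat.pair e n) (t n) ∈ X) :
    IsPath (treeAt e) fun n => (t n).unpair.1.unpair.1 := by
  refine isPath_of_certTree (g := fun n => (t n).unpair.1) fun k => ?_
  obtain ⟨N, hN⟩ : ∃ N, ∀ n ∈ Finset.range (k + 1), Nat.pair (Nat.pair e n) (t n) < N :=
    ((Filter.eventually_all_finset _).2 fun n _ => Filter.eventually_gt_atTop _).exists
  obtain ⟨G, hG⟩ := (hX N).exists_family
  have hG' (n : ℕ) (hn : n ≤ k) := hG e n (t n) (hN n (by simpa using Nat.lt_succ_of_le hn)) (h n)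
  rw [initSeg_congr fun i hi => (hG' i hi.le).1.symm]
  exact (hG' 0 (Nat.zero_le k)).2 k

/-- There is a set that is reticently high for paths but not
loquaciously high for paths. -/
theorem exists_retHighForPaths_not_loqHighForPaths :
    ∃ X : Set ℕ, RetHighForPaths X ∧ ¬ LoqHighForPaths X := by
  obtain ⟨X, hX, hgen⟩ := exists_generic (ι := Code ⊕ ℕ × ℕ)
    (D := Sum.elim ForcesNotLoq fun p σ => IllFounded (treeAt p.1) →
      ∃ t, Nat.pair (Nat.pair p.1 p.2) t < σ.length ∧
        σ.getD (Nat.pair (Nat.pair p.1 p.2) t) 0 = 1) <| by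
    rintro (c | p) τ hτ
    · exact hτ.exists_forcesNotLoq c
    · by_cases h : IllFounded (treeAt p.1)
      · obtain ⟨σ, h₁, h₂, h₃⟩ := hτ.exists_extension h p.2
        exact ⟨σ, h₁, h₂, fun _ => h₃⟩
      · exact ⟨τ, hτ, List.prefix_rfl, fun h' => absurd h' h⟩
  refine ⟨X, ⟨readPath X, partrecIn_readPath X, fun e he => ?_, fun e he n hdom => ?_⟩, ?_⟩
  · have hmem (n : ℕ) : ∃ t, Nat.pair (Nat.pair e n) t ∈ X := by
      obtain ⟨σ, hσ, hD⟩ := hgen (.inr (e, n))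
      obtain ⟨t, ht, ht'⟩ := hD he
      rw [← hσ, getD_initSeg _ ht] at ht'
      exact ⟨t, chi_eq_one.1 ht'⟩
    have hfind (n : ℕ) : ∃ t, Nat.pair (Nat.pair e n) t ∈ X ∧
        readPath X (e, n) = Part.some t.unpair.1.unpair.1 := by
      obtain ⟨t, ht⟩ := hmem n
      obtain ⟨u, hu, -⟩ := Nat.rfind_min'
        (p := fun t => decide (1 - chi X (Nat.pair (Nat.pair e n) t) = 0))
        (decide_eq_true (one_sub_chi_eq_zero.2 ht))
      refine ⟨u, ?_, Part.eq_some_iff.2 (Part.mem_map _ hu)⟩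
      have := Nat.rfind_spec hu
      simpa [one_sub_chi_eq_zero] using this
    choose t ht ht' using hfind
    exact ⟨_, isPath_of_mem hX ht, ht'⟩
  · obtain ⟨v, hv⟩ := Part.dom_iff_mem.1 hdom
    obtain ⟨t, ht, -⟩ := (Part.mem_map_iff _).1 hv
    have := Nat.rfind_spec ht
    rw [Part.mem_some_iff, eq_comm, decide_eq_true_iff, one_sub_chi_eq_zero] at this
    exact he (illFounded_of_mem hX this)
  · rintro ⟨F, hF, hpath⟩
    have hF' : RecursiveIn (chi X) fun n => Part.some (F n.unpair) := by
      unfold ComputableIn PartrecIn at hF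
      convert hF using 2 with n
      simp
    obtain ⟨c, hc⟩ := hF'.exists_finEval
    obtain ⟨σ, hσ, hD⟩ := hgen (.inl c)
    obtain ⟨e, he, hne⟩ := hD X hX hσ F hc
    exact hne (hpath e he)

end CFT
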